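/- Let ω, τ₀ ∈ ℝ with sin(ωτ₀/2) ≠ 0, let ε ∈ ℝ, let τ(t) := τ₀ + ε sin(ωt), and let h_ε(λ) := λ + ε (cos(ωτ₀/2) − cos(ωλ + ωτ₀/2)) / (2 sin(ωτ₀/2)). Then h_ε'(0) · (1 − τ'(0)) − h_ε'(−τ₀) = −ε² ω² / 2; equivalently, the error measure e := |h_ε'(0)(1 − τ'(0)) − h_ε'(−τ₀)| equals ε² ω² / 2. -/

import Mathlib

/-- For the sinusoidal delay τ(t) = τ₀ + ε sin(ωt) and the
first-order approximate time-transformation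
h_ε(λ) = λ + ε(cos(ωτ₀/2) − cos(ωλ + ωτ₀/2))/(2 sin(ωτ₀/2)), the seed-matching
defect is h_ε'(0)(1 − τ'(0)) − h_ε'(−τ₀) = −ε²ω²/2; equivalently the error
measure e = |h_ε'(0)(1 − τ'(0)) − h_ε'(−τ₀)| equals ε²ω²/2. -/
theorem sinusoidal_first_order_error_measure
    (ω τ₀ : ℝ) (hs : Real.sin (ω * τ₀ / 2) ≠ 0) (ε : ℝ)
    (τ : ℝ → ℝ) (hτ : ∀ t : ℝ, τ t = τ₀ + ε * Real.sin (ω * t))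
    (he : ℝ → ℝ)
    (hhe : ∀ l : ℝ, he l = l +
      ε * (Real.cos (ω * τ₀ / 2) - Real.cos (ω * l + ω * τ₀ / 2)) / (2 * Real.sin (ω * τ₀ / 2))) :
    deriv he 0 * (1 - deriv τ 0) - deriv he (-τ₀) = -(ε ^ 2 * ω ^ 2 / 2) ∧
      |deriv he 0 * (1 - deriv τ 0) - deriv he (-τ₀)| = ε ^ 2 * ω ^ 2 / 2 := by
  have deriv_delay : deriv τ 0 = ε * ω := by
    rw [funext hτ]
    have h := ((((hasDerivAt_id (0 : ℝ)).const_mul ω).sin).const_mul ε).const_add τ₀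
    simpa using h.deriv
  have deriv_transform (l : ℝ) : deriv he l =
      1 + ε * (Real.sin (ω * l + ω * τ₀ / 2) * ω) / (2 * Real.sin (ω * τ₀ / 2)) := by
    rw [funext hhe]
    have h := (hasDerivAt_id l).add ((((((((hasDerivAt_id l).const_mul ω).add_const
      (ω * τ₀ / 2)).cos).const_sub (Real.cos (ω * τ₀ / 2))).const_mul ε)).div_const
      (2 * Real.sin (ω * τ₀ / 2)))
    refine (HasDerivAt.congr_deriv h ?_).deriv
    simp
  have defect : deriv he 0 * (1 - deriv τ 0) - deriv he (-τ₀) = -(ε ^ 2 * ω ^ 2 / 2) := by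
    have angle : ω * -τ₀ + ω * τ₀ / 2 = -(ω * τ₀ / 2) := by ring
    rw [deriv_delay, deriv_transform, deriv_transform, angle, Real.sin_neg, mul_zero, zero_add]
    field_simp
    ring
  refine ⟨defect, ?_⟩
  rw [defect, abs_neg, abs_of_nonneg (by positivity)]
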